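/- Let A : ℕ → ℕ → ℤ[q] be the family of polynomials determined by A n 0 = 1 for all n ≥ 1, A 0 r = 0 for all r ≥ 1, and the recurrence A (n+1) (r+1) = q^(r+1) · A n (r+1) + (q^(n−r) − q^r) · A n r for all n, r ≥ 0. Then for every n ≥ 1, the following identity holds in ℤ[q]: Σ_{r=0}^{n} A (2n) r = Σ_{j ∈ ℤ} [C(2n, n−3j) − C(2n, n−3j−1)] · q^(n²−3j²−j), where C(m,k) denotes the ordinary binomial coefficient with C(m,k) = 0 unless 0 ≤ k ≤ m (so the right-hand sum has finitely many nonzero terms, each with nonnegative exponent n²−3j²−j). -/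

import Mathlib

open Polynomial

/-- Ordinary binomial coefficient with an integer lower index, with the
convention that `C(m, k) = 0` unless `0 ≤ k ≤ m`. -/
def intChoose (m : ℕ) (k : ℤ) : ℤ :=
  if 0 ≤ k then (m.choose k.toNat : ℤ) else 0

/-- `gg m j` is the Gaussian binomial `[m - j; j]`. -/
noncomputable def gg : ℕ → ℕ → ℤ[X]
  | _, 0 => 1
  | 0, _ + 1 => 0
  | 1, _ + 1 => 0
  | m + 2, j + 1 => X ^ (j + 1) * gg (m + 1) (j + 1) + gg m j

theorem gg_zero (m : ℕ) : gg m 0 = 1 := by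
  rcases m with _ | _ | m <;> simp [gg]

theorem gg_rec (m j : ℕ) :
    gg (m + 2) (j + 1) = X ^ (j + 1) * gg (m + 1) (j + 1) + gg m j := by
  simp [gg]

theorem gg_vanish (m : ℕ) : ∀ j, m < 2 * j → gg m j = 0 := by
  induction m using Nat.strong_induction_on with
  | _ m ih =>
    intro j hj
    rcases j with _ | j
    · omega
    rcases m with _ | _ | m
    · simp [gg]
    · simp [gg]
    · rw [gg_rec, ih (m + 1) (by omega) (j + 1) (by omega), ih m (by omega) j (by omega)]
      simp

theorem gg_rec2 (d : ℕ) : ∀ j, gg (2 * j + d + 2) (j + 1) =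
    gg (2 * j + d + 1) (j + 1) + X ^ d * gg (2 * j + d) j := by
  induction d with
  | zero =>
    intro j
    rw [gg_rec, gg_vanish (2 * j + 0 + 1) (j + 1) (by omega)]
    simp
  | succ d ihd =>
    intro j
    induction j with
    | zero =>
      have h1 := gg_rec (2 * 0 + (d + 1)) 0
      have h2 := gg_rec (2 * 0 + d) 0
      have h3 := ihd 0
      rw [h1]
      have e1 : 2 * 0 + (d + 1) + 1 = 2 * 0 + d + 2 := by ring
      rw [e1]
      simp only [gg_zero] at *
      linear_combination (X ^ (0 + 1)) * h3 - h2
    | succ j ihj =>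
      have h0 := gg_rec (2 * j + d + 3) (j + 1)
      have h1 := gg_rec (2 * j + d + 2) (j + 1)
      have h2 := gg_rec (2 * j + d + 1) j
      have h3 := ihd (j + 1)
      have e1 : 2 * (j + 1) + (d + 1) + 2 = 2 * j + d + 3 + 2 := by ring
      have e2 : 2 * (j + 1) + (d + 1) + 1 = 2 * j + d + 2 + 2 := by ring
      have e3 : 2 * (j + 1) + (d + 1) = 2 * j + d + 3 := by ring
      have e4 : 2 * (j + 1) + d + 2 = 2 * j + d + 4 := by ring
      have e5 : 2 * (j + 1) + d + 1 = 2 * j + d + 3 := by ring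
      have e6 : 2 * (j + 1) + d = 2 * j + d + 2 := by ring
      have e7 : 2 * j + (d + 1) + 2 = 2 * j + d + 3 := by ring
      have e8 : 2 * j + (d + 1) + 1 = 2 * j + d + 2 := by ring
      have e9 : 2 * j + (d + 1) = 2 * j + d + 1 := by ring
      rw [e1, e2, e3]
      rw [e4, e5, e6] at h3
      rw [e7, e8, e9] at ihj
      simp only [Nat.add_assoc, Nat.reduceAdd] at *
      linear_combination h0 + (X ^ (j + 2)) * h3 - h1 + ihj - X ^ (d + 1) * h2

theorem gg_key (j : ℕ) : ∀ d, (1 - X ^ (d + 1)) * gg (2 * j + d + 1) j =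
    (1 - X ^ (j + d + 1)) * gg (2 * j + d) j := by
  induction j with
  | zero => intro d; simp [gg_zero]
  | succ j ih =>
    intro d
    have h0 := gg_rec (2 * j + d + 1) j
    have h1 := gg_rec (2 * j + d) j
    have h2 := gg_rec2 d j
    have h3 := ih d
    have e1 : 2 * (j + 1) + d + 1 = 2 * j + d + 3 := by ring
    have e2 : 2 * (j + 1) + d = 2 * j + d + 2 := by ring
    rw [e1, e2]
    simp only [Nat.add_assoc, Nat.reduceAdd] at *
    linear_combination (1 - X ^ (d + 1)) * h0 + h3 - h1 + X ^ (j + 1) * h2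

noncomputable def PP (M m : ℕ) : ℤ[X] :=
  ∑ j ∈ Finset.range M, (-1) ^ j * X ^ (j.choose 2) * gg m j

noncomputable def RR (M m : ℕ) : ℤ[X] :=
  ∑ j ∈ Finset.range M, (-1) ^ j * X ^ (j.choose 2) * X ^ (m - j) * gg m j

theorem choose_two_succ (j : ℕ) : (j + 1).choose 2 = j.choose 2 + j := by
  rw [Nat.choose_succ_succ' j 1, Nat.choose_one_right]; ring

theorem PP_rec (M m : ℕ) : PP (M + 1) (m + 2) = PP (M + 1) (m + 1) - RR M m := by
  unfold PP RR
  rw [Finset.sum_range_succ', Finset.sum_range_succ' (n := M)]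
  rw [eq_sub_iff_add_eq, add_right_comm, ← Finset.sum_add_distrib]
  simp only [gg_zero]
  congr 1
  apply Finset.sum_congr rfl
  intro j _
  by_cases h : 2 * j ≤ m
  · obtain ⟨d, rfl⟩ := Nat.exists_eq_add_of_le h
    have : 2 * j + d - j = j + d := by omega
    rw [gg_rec2, this, choose_two_succ]
    ring
  · rw [gg_vanish m j (by omega), gg_vanish (m + 2) _ (by omega), gg_vanish (m + 1) _ (by omega)]
    simp

theorem RR_rec (M m : ℕ) :
    RR (M + 1) (m + 2) = X ^ (m + 2) * PP (M + 1) (m + 1) - X ^ (m + 1) * PP M m := by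
  unfold PP RR
  rw [Finset.sum_range_succ', Finset.sum_range_succ' (n := M)]
  rw [eq_sub_iff_add_eq, mul_add, add_right_comm, Finset.mul_sum, Finset.mul_sum,
    ← Finset.sum_add_distrib]
  simp only [gg_zero]
  congr 1
  · apply Finset.sum_congr rfl
    intro j _
    by_cases h : j ≤ m
    · obtain ⟨d, rfl⟩ := Nat.exists_eq_add_of_le h
      have : j + d + 2 - (j + 1) = d + 1 := by omega
      rw [gg_rec, this, choose_two_succ]
      ring
    · rw [gg_vanish m j (by omega), gg_vanish (m + 2) _ (by omega),
        gg_vanish (m + 1) _ (by omega)]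
      simp
  · simp

noncomputable def pp (m : ℕ) : ℤ[X] := PP (m + 1) m

theorem PP_eq (M m : ℕ) (h : m < 2 * M) : PP M m = pp m := by
  have key : ∀ k, PP (M + k) m = PP M m := by
    intro k
    unfold PP
    rw [Finset.sum_range_add]
    rw [Finset.sum_eq_zero (s := Finset.range k), add_zero]
    intro x _
    rw [gg_vanish _ _ (by omega), mul_zero]
  have key2 : ∀ k, PP (m + 1 + k) m = PP (m + 1) m := by
    intro k
    unfold PP
    rw [Finset.sum_range_add]
    rw [Finset.sum_eq_zero (s := Finset.range k), add_zero]
    intro x _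
    rw [gg_vanish _ _ (by omega), mul_zero]
  rw [pp, ← key (m + 1), ← key2 M, add_comm]

theorem pp_rec4 (m : ℕ) :
    pp (m + 4) = pp (m + 3) - X ^ (m + 2) * pp (m + 1) + X ^ (m + 1) * pp m := by
  have h := PP_rec (m + 3 + 1) (m + 2)
  rw [RR_rec] at h
  rw [PP_eq _ _ (by omega), PP_eq _ _ (by omega), PP_eq _ _ (by omega), PP_eq _ _ (by omega)] at h
  rw [h]; ring

theorem pp_rec3 (m : ℕ) : pp (m + 3) = - X ^ (m + 1) * pp m := by
  induction m with
  | zero =>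
    simp [pp, PP, Finset.sum_range_succ, gg]
  | succ m ih =>
    have := pp_rec4 m
    simp only [Nat.add_assoc, Nat.reduceAdd] at *
    linear_combination this + ih

theorem pp_rec6 (m : ℕ) : pp (m + 6) = X ^ (2 * m + 5) * pp m := by
  have h1 := pp_rec3 m
  have h2 := pp_rec3 (m + 3)
  simp only [Nat.add_assoc, Nat.reduceAdd] at *
  rw [h2, h1]; ring

theorem pp_0 (b : ℕ) : pp (6 * b) = X ^ (b * (6 * b - 1)) := by
  induction b with
  | zero => simp [pp, PP, gg]
  | succ b ih =>
    rw [show 6 * (b + 1) = 6 * b + 6 by ring, pp_rec6, ih, ← pow_add]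
    congr 1
    rcases b with _ | b
    · simp
    · rw [show 6 * (b + 1) - 1 = 6 * b + 5 by omega,
        show 6 * (b + 1) + 6 - 1 = 6 * b + 11 by omega]
      ring

theorem pp_2 (b : ℕ) : pp (6 * b + 2) = 0 := by
  induction b with
  | zero => simp [pp, PP, gg, Finset.sum_range_succ]
  | succ b ih =>
    rw [show 6 * (b + 1) + 2 = 6 * b + 2 + 6 by ring, pp_rec6, ih, mul_zero]

theorem pp_4 (b : ℕ) : pp (6 * b + 4) = - X ^ ((2 * b + 1) * (3 * b + 2)) := by
  induction b with
  | zero => 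
    have := pp_rec3 1
    simp at this ⊢
    rw [this]
    simp [pp, PP, gg, Finset.sum_range_succ]
  | succ b ih =>
    rw [show 6 * (b + 1) + 4 = 6 * b + 4 + 6 by ring, pp_rec6, ih]
    ring

def cc : ℕ → ℕ → ℤ
  | _, 0 => 1
  | n, k + 1 => n.choose (k + 1) - n.choose k

theorem cc_zero (n : ℕ) : cc n 0 = 1 := rfl

theorem cc_rec (n k : ℕ) : cc (n + 1) (k + 1) = cc n (k + 1) + cc n k := by
  rcases k with _ | k
  · simp [cc]
  · simp only [cc, Nat.choose_succ_succ']
    push_cast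
    ring

noncomputable def uu (n k j : ℕ) : ℤ[X] :=
  (-1) ^ j * X ^ (k * (n - k)) * X ^ (j.choose 2) * gg (n - 2 * k) j

theorem uu_key (k j s : ℕ) :
    uu (2 * k + 2 * j + 1 + s + 1) k (j + 1) + uu (2 * k + 2 * j + 1 + s + 1) (k + 1) j =
    X ^ (k + j + 1) * uu (2 * k + 2 * j + 1 + s) k (j + 1) +
      (X ^ (k + j + 1 + s) - X ^ (k + j)) * uu (2 * k + 2 * j + 1 + s) k j := by
  unfold uu
  rw [show 2 * k + 2 * j + 1 + s + 1 - k = k + (2 * j + 2 + s) by omega,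
    show 2 * k + 2 * j + 1 + s + 1 - 2 * k = 2 * j + s + 2 by omega,
    show 2 * k + 2 * j + 1 + s + 1 - (k + 1) = k + (2 * j + 1 + s) by omega,
    show 2 * k + 2 * j + 1 + s + 1 - 2 * (k + 1) = 2 * j + s by omega,
    show 2 * k + 2 * j + 1 + s - k = k + (2 * j + 1 + s) by omega,
    show 2 * k + 2 * j + 1 + s - 2 * k = 2 * j + s + 1 by omega,
    choose_two_succ, gg_rec]
  have h := gg_key j s
  linear_combination (-1) ^ j * X ^ (k * (k + (2 * j + 1 + s))) * X ^ (j.choose 2) *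
    X ^ (k + j) * h

noncomputable def FF (n r : ℕ) : ℤ[X] :=
  ∑ k ∈ Finset.range (r + 1), C (cc n k) * uu n k (r - k)

theorem FF_zero (n : ℕ) : FF n 0 = 1 := by
  simp [FF, uu, cc, gg_zero]

theorem FF_vanish (r : ℕ) : FF (2 * r + 1) (r + 1) = 0 := by
  unfold FF
  rw [Finset.sum_range_succ, Finset.sum_eq_zero]
  · have : cc (2 * r + 1) (r + 1) = 0 := by
      simp only [cc]
      rw [Nat.choose_symm_half]
      simp
    rw [this]; simp
  · intro k hk
    rw [Finset.mem_range] at hk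
    rw [uu, gg_vanish _ _ (by omega)]
    simp

theorem FF_rec (r s : ℕ) : FF (2 * r + 1 + s + 1) (r + 1) =
    X ^ (r + 1) * FF (2 * r + 1 + s) (r + 1) +
      (X ^ (r + 1 + s) - X ^ r) * FF (2 * r + 1 + s) r := by
  obtain ⟨n, hn⟩ : ∃ n, n = 2 * r + 1 + s := ⟨_, rfl⟩
  rw [← hn]
  have h1 : FF (n + 1) (r + 1) =
      ∑ k ∈ Finset.range (r + 1 + 1), C (cc n k) * uu (n + 1) k (r + 1 - k) +
      ∑ k ∈ Finset.range (r + 1), C (cc n k) * uu (n + 1) (k + 1) (r - k) := by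
    unfold FF
    have e : ∑ k ∈ Finset.range (r + 1),
          C (cc (n + 1) (k + 1)) * uu (n + 1) (k + 1) (r + 1 - (k + 1)) =
        ∑ k ∈ Finset.range (r + 1),
          C (cc n (k + 1)) * uu (n + 1) (k + 1) (r + 1 - (k + 1)) +
        ∑ k ∈ Finset.range (r + 1), C (cc n k) * uu (n + 1) (k + 1) (r - k) := by
      rw [← Finset.sum_add_distrib]
      apply Finset.sum_congr rfl
      intro k _
      rw [cc_rec, Nat.add_sub_add_right, C_add]
      ring
    rw [Finset.sum_range_succ', Finset.sum_range_succ' (n := r + 1), e, cc_zero, cc_zero]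
    ring
  have h2 : ∑ k ∈ Finset.range (r + 1), C (cc n k) * uu (n + 1) k (r + 1 - k) +
      ∑ k ∈ Finset.range (r + 1), C (cc n k) * uu (n + 1) (k + 1) (r - k) =
      X ^ (r + 1) * ∑ k ∈ Finset.range (r + 1), C (cc n k) * uu n k (r + 1 - k) +
      (X ^ (r + 1 + s) - X ^ r) * ∑ k ∈ Finset.range (r + 1), C (cc n k) * uu n k (r - k) := by
    rw [Finset.mul_sum, Finset.mul_sum, ← Finset.sum_add_distrib, ← Finset.sum_add_distrib]
    apply Finset.sum_congr rfl
    intro k hk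
    rw [Finset.mem_range] at hk
    obtain ⟨j, rfl⟩ := Nat.exists_eq_add_of_le (Nat.le_of_lt_succ hk)
    rw [show k + j + 1 - k = j + 1 by omega, show k + j - k = j by omega]
    have h := uu_key k j s
    rw [show 2 * k + 2 * j + 1 + s = n by omega] at h
    linear_combination C (cc n k) * h
  have h3 : uu (n + 1) (r + 1) (r + 1 - (r + 1)) =
      X ^ (r + 1) * uu n (r + 1) (r + 1 - (r + 1)) := by
    rw [Nat.sub_self]
    unfold uu
    rw [show n + 1 - (r + 1) = r + s + 1 by omega, show n - (r + 1) = r + s by omega]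
    simp only [gg_zero]
    ring
  rw [h1]
  unfold FF
  rw [Finset.sum_range_succ, Finset.sum_range_succ (n := r + 1)]
  linear_combination h2 + C (cc n (r + 1)) * h3

theorem A_vanish (A : ℕ → ℕ → Polynomial ℤ)
    (hA0 : ∀ r : ℕ, 1 ≤ r → A 0 r = 0)
    (hrec : ∀ n r : ℕ, A (n + 1) (r + 1) =
      (X : Polynomial ℤ) ^ (r + 1) * A n (r + 1) +
        ((X : Polynomial ℤ) ^ (n - r) - (X : Polynomial ℤ) ^ r) * A n r)
    (n : ℕ) : ∀ r, n < 2 * r → A n r = 0 := by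
  induction n with
  | zero => intro r hr; exact hA0 r (by omega)
  | succ n ih =>
    intro r hr
    rcases r with _ | r
    · omega
    rw [hrec, ih (r + 1) (by omega)]
    by_cases h : n = 2 * r
    · rw [h, show 2 * r - r = r by omega]; simp
    · rw [ih r (by omega)]; simp

theorem A_eq (A : ℕ → ℕ → Polynomial ℤ)
    (hA1 : ∀ n : ℕ, 1 ≤ n → A n 0 = 1)
    (hA0 : ∀ r : ℕ, 1 ≤ r → A 0 r = 0)
    (hrec : ∀ n r : ℕ, A (n + 1) (r + 1) =
      (X : Polynomial ℤ) ^ (r + 1) * A n (r + 1) +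
        ((X : Polynomial ℤ) ^ (n - r) - (X : Polynomial ℤ) ^ r) * A n r)
    (n : ℕ) : 1 ≤ n → ∀ r, 2 * r ≤ n → A n r = FF n r := by
  induction n with
  | zero => intro h; omega
  | succ n ih =>
    intro _ r hr
    rcases r with _ | r
    · rw [hA1 _ (by omega), FF_zero]
    obtain ⟨s, rfl⟩ : ∃ s, n = 2 * r + 1 + s := ⟨n - (2 * r + 1), by omega⟩
    rw [hrec, FF_rec, ih (by omega) r (by omega), show 2 * r + 1 + s - r = r + 1 + s by omega]
    rcases s with _ | s
    · rw [A_vanish A hA0 hrec _ _ (by omega), add_zero, FF_vanish]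
    · rw [ih (by omega) (r + 1) (by omega)]

theorem A_sum (A : ℕ → ℕ → Polynomial ℤ)
    (hA1 : ∀ n : ℕ, 1 ≤ n → A n 0 = 1)
    (hA0 : ∀ r : ℕ, 1 ≤ r → A 0 r = 0)
    (hrec : ∀ n r : ℕ, A (n + 1) (r + 1) =
      (X : Polynomial ℤ) ^ (r + 1) * A n (r + 1) +
        ((X : Polynomial ℤ) ^ (n - r) - (X : Polynomial ℤ) ^ r) * A n r)
    (n : ℕ) (hn : 1 ≤ n) : ∑ r ∈ Finset.range (n + 1), A (2 * n) r =
    ∑ i ∈ Finset.range (n + 1), C (cc (2 * n) (n - i)) * X ^ (n ^ 2 - i ^ 2) * pp (2 * i) := by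
  have h1 : ∑ r ∈ Finset.range (n + 1), A (2 * n) r =
      ∑ r ∈ Finset.range (n + 1), FF (2 * n) r := by
    apply Finset.sum_congr rfl
    intro r hr
    rw [Finset.mem_range] at hr
    exact A_eq A hA1 hA0 hrec _ (by omega) _ (by omega)
  rw [h1]
  unfold FF
  rw [Finset.sum_range_diag_flip (n + 1) (fun k j => C (cc (2 * n) k) * uu (2 * n) k j)]
  rw [← Finset.sum_range_reflect]
  apply Finset.sum_congr rfl
  intro i hi
  rw [Finset.mem_range] at hi
  obtain ⟨d, rfl⟩ := Nat.exists_eq_add_of_le (Nat.le_of_lt_succ hi)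
  rw [show i + d + 1 - 1 - i = d by omega, show i + d - i = d by omega,
    show i + d + 1 - d = i + 1 by omega, ← PP_eq (i + 1) (2 * i) (by omega), PP, Finset.mul_sum]
  apply Finset.sum_congr rfl
  intro j _
  rw [uu, show 2 * (i + d) - d = 2 * i + d by omega, show 2 * (i + d) - 2 * d = 2 * i by omega,
    show (i + d) ^ 2 - i ^ 2 = d * (2 * i + d) by
      rw [Nat.sub_eq_iff_eq_add (Nat.pow_le_pow_left (by omega) 2)]; ring]
  ring

theorem intChoose_nat (m k : ℕ) : intChoose m (k : ℤ) = m.choose k := by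
  simp [intChoose]

theorem intChoose_neg (m : ℕ) (k : ℤ) (h : k < 0) : intChoose m k = 0 := by
  rw [intChoose, if_neg (by omega)]

theorem intChoose_big (m : ℕ) (k : ℤ) (h : m < k) : intChoose m k = 0 := by
  rw [intChoose, if_pos (by omega), Nat.choose_eq_zero_of_lt (by omega)]; simp

theorem intChoose_symm (m : ℕ) (k : ℤ) : intChoose m (m - k) = intChoose m k := by
  by_cases h : k < 0
  · rw [intChoose_neg m k h, intChoose_big _ _ (by omega)]
  by_cases h2 : m < k
  · rw [intChoose_big m k h2, intChoose_neg _ _ (by omega)]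
  · obtain ⟨k, rfl⟩ := Int.eq_ofNat_of_zero_le (not_lt.mp h)
    rw [show (m : ℤ) - k = ((m - k : ℕ) : ℤ) by omega, intChoose_nat, intChoose_nat,
      Nat.choose_symm (by omega)]

theorem cc_eq (m k : ℕ) : cc m k = intChoose m k - intChoose m (k - 1) := by
  rcases k with _ | k
  · rw [intChoose_nat, intChoose_neg _ _ (by simp)]; simp [cc]
  · rw [show (((k + 1 : ℕ) : ℤ) - 1) = (k : ℤ) by push_cast; ring, intChoose_nat, intChoose_nat]
    rfl

/-- Left side term. -/
noncomputable def hh (n i : ℕ) : ℤ[X] :=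
  C (intChoose (2 * n) (n - i) - intChoose (2 * n) (n - i - 1)) * X ^ (n ^ 2 - i ^ 2) * pp (2 * i)

/-- Right side term. -/
noncomputable def ff (n : ℕ) (j : ℤ) : ℤ[X] :=
  Polynomial.C
    (intChoose (2 * n) ((n : ℤ) - 3 * j) - intChoose (2 * n) ((n : ℤ) - 3 * j - 1)) *
      (X : Polynomial ℤ) ^ ((n : ℤ) ^ 2 - 3 * j ^ 2 - j).toNat

theorem hh_vanish (n i : ℕ) (h : n < i) : hh n i = 0 := by
  rw [hh, intChoose_neg _ _ (by omega), intChoose_neg _ _ (by omega)]; simp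

theorem hh_1 (n b : ℕ) : hh n (3 * b + 1) = 0 := by
  rw [hh, show 2 * (3 * b + 1) = 6 * b + 2 by ring, pp_2, mul_zero]

theorem hh_0 (n b : ℕ) : hh n (3 * b) = ff n b := by
  by_cases h : n < 3 * b
  · rw [hh_vanish _ _ h, ff, intChoose_neg _ _ (by omega), intChoose_neg _ _ (by omega)]; simp
  · rw [hh, ff, show 2 * (3 * b) = 6 * b by ring, pp_0, mul_assoc, ← pow_add]
    push_cast
    congr 2
    have h1 : (3 * b) ^ 2 ≤ n ^ 2 := Nat.pow_le_pow_left (by omega) 2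
    have h2 : ((b * (6 * b - 1) : ℕ) : ℤ) = b * (6 * b - 1) := by
      rcases b with _ | b
      · simp
      · rw [show 6 * (b + 1) - 1 = 6 * b + 5 by omega]; push_cast; ring
    have : ((n : ℤ) ^ 2 - 3 * b ^ 2 - b) = ((n ^ 2 - (3 * b) ^ 2 + b * (6 * b - 1) : ℕ) : ℤ) := by
      rw [Nat.cast_add, Nat.cast_sub h1, h2]; push_cast; ring
    rw [this, Int.toNat_natCast]

theorem hh_2 (n b : ℕ) : hh n (3 * b + 2) = ff n (-(b + 1 : ℕ)) := by
  have hc : intChoose (2 * n) ((n : ℤ) - 3 * (-(b + 1 : ℕ))) -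
      intChoose (2 * n) ((n : ℤ) - 3 * (-(b + 1 : ℕ)) - 1) =
      -(intChoose (2 * n) ((n : ℤ) - (3 * b + 2 : ℕ)) -
        intChoose (2 * n) ((n : ℤ) - (3 * b + 2 : ℕ) - 1)) := by
    rw [← intChoose_symm (2 * n) ((n : ℤ) - (3 * b + 2 : ℕ)),
      ← intChoose_symm (2 * n) ((n : ℤ) - (3 * b + 2 : ℕ) - 1)]
    rw [neg_sub]
    congr 2 <;> push_cast <;> ring
  by_cases h : n < 3 * b + 2
  · rw [hh_vanish _ _ h, ff, hc, intChoose_neg _ _ (by omega), intChoose_neg _ _ (by omega)]; simp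
  · rw [hh, ff, hc, show 2 * (3 * b + 2) = 6 * b + 4 by ring, pp_4, C_neg, neg_mul, mul_neg,
      mul_assoc, ← pow_add]
    congr 3
    have h1 : (3 * b + 2) ^ 2 ≤ n ^ 2 := Nat.pow_le_pow_left (by omega) 2
    have : ((n : ℤ) ^ 2 - 3 * (-(b + 1 : ℕ)) ^ 2 - (-(b + 1 : ℕ))) =
        ((n ^ 2 - (3 * b + 2) ^ 2 + (2 * b + 1) * (3 * b + 2) : ℕ) : ℤ) := by
      push_cast [Nat.cast_sub h1]; ring
    rw [this, Int.toNat_natCast]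

theorem sum_three (h : ℕ → ℤ[X]) (M : ℕ) : ∑ i ∈ Finset.range (3 * M), h i =
    ∑ b ∈ Finset.range M, (h (3 * b) + h (3 * b + 1) + h (3 * b + 2)) := by
  induction M with
  | zero => simp
  | succ M ih =>
    rw [show 3 * (M + 1) = 3 * M + 1 + 1 + 1 by ring, Finset.sum_range_succ, Finset.sum_range_succ,
      Finset.sum_range_succ, ih, Finset.sum_range_succ]
    ring

theorem sum_Ico_int (f : ℤ → ℤ[X]) (M : ℕ) : ∑ j ∈ Finset.Ico (-(M : ℤ)) M, f j =
    ∑ b ∈ Finset.range M, (f b + f (-(b + 1 : ℕ))) := by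
  induction M with
  | zero => simp
  | succ M ih =>
    have e : Finset.Ico (-((M + 1 : ℕ) : ℤ)) ((M + 1 : ℕ) : ℤ) =
        insert (-((M + 1 : ℕ) : ℤ)) (insert (M : ℤ) (Finset.Ico (-(M : ℤ)) M)) := by
      ext x
      simp only [Finset.mem_Ico, Finset.mem_insert]
      omega
    rw [e, Finset.sum_insert, Finset.sum_insert, ih, Finset.sum_range_succ]
    · ring
    · simp
    · simp only [Finset.mem_Ico, Finset.mem_insert]
      omega

theorem kirillov_A_sum_even (A : ℕ → ℕ → Polynomial ℤ)
    (hA1 : ∀ n : ℕ, 1 ≤ n → A n 0 = 1)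
    (hA0 : ∀ r : ℕ, 1 ≤ r → A 0 r = 0)
    (hrec : ∀ n r : ℕ, A (n + 1) (r + 1) =
      (X : Polynomial ℤ) ^ (r + 1) * A n (r + 1) +
        ((X : Polynomial ℤ) ^ (n - r) - (X : Polynomial ℤ) ^ r) * A n r)
    (n : ℕ) (hn : 1 ≤ n) :
    ∑ r ∈ Finset.range (n + 1), A (2 * n) r =
      ∑ᶠ j : ℤ,
        Polynomial.C
            (intChoose (2 * n) ((n : ℤ) - 3 * j) - intChoose (2 * n) ((n : ℤ) - 3 * j - 1)) *
          (X : Polynomial ℤ) ^ ((n : ℤ) ^ 2 - 3 * j ^ 2 - j).toNat := by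
  rw [A_sum A hA1 hA0 hrec n hn]
  change _ = ∑ᶠ j : ℤ, ff n j
  rw [finsum_eq_sum_of_support_subset (s := Finset.Ico (-((n + 1 : ℕ) : ℤ)) ((n + 1 : ℕ) : ℤ)),
    sum_Ico_int]
  · have h1 : ∑ i ∈ Finset.range (n + 1),
        C (cc (2 * n) (n - i)) * X ^ (n ^ 2 - i ^ 2) * pp (2 * i) =
        ∑ i ∈ Finset.range (n + 1), hh n i := by
      apply Finset.sum_congr rfl
      intro i hi
      rw [Finset.mem_range] at hi
      rw [hh, cc_eq, Nat.cast_sub (by omega)]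
    have h2 : ∑ i ∈ Finset.range (n + 1), hh n i = ∑ i ∈ Finset.range (3 * (n + 1)), hh n i := by
      apply Finset.sum_subset
      · intro x
        simp only [Finset.mem_range]
        omega
      · intro x _ hx
        rw [Finset.mem_range] at hx
        exact hh_vanish _ _ (by omega)
    rw [h1, h2, sum_three]
    apply Finset.sum_congr rfl
    intro b _
    rw [hh_0, hh_1, hh_2, add_zero]
  · intro j hj
    by_contra hc
    apply hj
    simp only [Finset.coe_Ico, Set.mem_Ico, not_and_or, not_le, not_lt] at hc
    rcases hc with hc | hc
    · rw [ff, intChoose_big _ _ (by push_cast at *; omega),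
        intChoose_big _ _ (by push_cast at *; omega)]
      simp
    · rw [ff, intChoose_neg _ _ (by push_cast at *; omega),
        intChoose_neg _ _ (by push_cast at *; omega)]
      simp
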